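/- arXiv:2008.12346 — 2 statements merged into one kernel-verified Lean document; each statement's English description precedes it below -/
import Mathlib

section
/- Let T ⊆ ℤ₂^ω be a thin set such that T ∩ X ≠ ∅ for every equivalence class X of ∼. Then the Banach–Mazur game G(T) is undetermined: neither Ego nor Alter has a winning strategy. -/
/-- The Cantor cube `ℤ₂^ω`, modeled as infinite binary sequences. -/
abbrev Cantor := ℕ → Bool

/-- The (possibly infinite) Hamming distance between two infinite binary sequences. -/
noncomputable def hd (x y : Cantor) : ℕ∞ := {n : ℕ | x n ≠ y n}.encard

/-- `T` is thin: `hd x y ≥ 2` for all distinct `x, y ∈ T`. -/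
def IsThin (T : Set Cantor) : Prop := ∀ x ∈ T, ∀ y ∈ T, x ≠ y → 2 ≤ hd x y

/-- The relation `x ∼ y` iff `hd x y < ∞`. -/
def simRel (x y : Cantor) : Prop := hd x y < ⊤

/-- The `∼`-equivalence class of `x`. -/
def simClass (x : Cantor) : Set Cantor := {y | simRel x y}

/-- `ℤ₂⁺`: nonempty finite binary words. -/
abbrev Word := {l : List Bool // l ≠ []}

instance : Inhabited Word := ⟨⟨[false], by simp⟩⟩

/-- An Ego strategy: a function from finite (possibly empty) sequences of words to words. -/
abbrev EgoStrategy := List Word → Word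

/-- An Alter strategy: a function from nonempty finite sequences of words to words. -/
abbrev AlterStrategy := {l : List Word // l ≠ []} → Word

/-- `hist e a n = ([ε₀, …, ε_n], [α₁, …, α_n])`, the first moves of both players:
`ε₀ = e(∅)`, `α_i = a(ε₀,…,ε_{i-1})`, `ε_i = e(α₁,…,α_i)`. -/
def hist (e : EgoStrategy) (a : AlterStrategy) :
    ℕ → {p : List Word × List Word // p.1 ≠ []}
  | 0 => ⟨([e []], []), by simp⟩
  | n + 1 =>
    let p := hist e a n
    let α := a ⟨p.1.1, p.2⟩
    let ε := e (p.1.2 ++ [α])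
    ⟨(p.1.1 ++ [ε], p.1.2 ++ [α]), by simp⟩

/-- The `n`-th move of the play: the moves are `ε₀, α₁, ε₁, α₂, ε₂, …`. -/
def moveSeq (e : EgoStrategy) (a : AlterStrategy) (n : ℕ) : Word :=
  if n % 2 = 0 then ((hist e a (n / 2)).1.1).getLastD default
  else ((hist e a ((n + 1) / 2)).1.2).getLastD default

/-- `Play e a ∈ ℤ₂^ω` is the infinite concatenation `ε₀α₁ε₁α₂ε₂⋯`. -/
def Play (e : EgoStrategy) (a : AlterStrategy) : Cantor := fun n =>
  ((List.ofFn (fun i : Fin (n + 1) => (moveSeq e a i).1)).flatten).getD n false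

/-- The sequence of the first `n` moves of `m`, most recent move first. -/
def revHistory (m : ℕ → Word) (n : ℕ) : List Word := ((List.range n).map m).reverse

lemma revHistory_succ (m : ℕ → Word) (n : ℕ) :
    revHistory m (n + 1) = m n :: revHistory m n := by
  simp [revHistory, List.range_succ]

/-- The word produced when a player makes the moves in the (reversed) list and each of them is
answered according to `σ`. -/
def answeredWord (σ : List Word → List Bool) : List Word → List Bool
  | [] => []
  | w :: t => answeredWord σ t ++ w.1 ++ σ (w :: t)

/-- The finite word `l` is an initial segment of the infinite sequence `x`. -/
def IsInitial (l : List Bool) (x : Cantor) : Prop := ∀ i b, l[i]? = some b → x i = b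

lemma IsInitial.of_prefix {l l' : List Bool} {x : Cantor} (h : IsInitial l' x) (hl : l <+: l') :
    IsInitial l x := fun i b hb => h i b (by
  obtain ⟨t, rfl⟩ := hl
  rwa [List.getElem?_append_left (List.getElem?_eq_some_iff.1 hb).1])

/-- The infinite sequence `x` with its initial segment of length `s.length` replaced by `s`. -/
def patch (s : List Bool) (x : Cantor) : Cantor := fun i => s[i]?.getD (x i)

lemma IsInitial.patch {l : List Bool} {x : Cantor} (h : IsInitial l x) (s : List Bool) :
    IsInitial (s ++ l.drop s.length) (patch s x) := by
  intro i b hb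
  rcases lt_or_ge i s.length with hi | hi
  · rw [List.getElem?_append_left hi] at hb
    simp [_root_.patch, hb]
  · rw [List.getElem?_append_right hi, List.getElem?_drop, Nat.add_sub_cancel' hi] at hb
    simp [_root_.patch, List.getElem?_eq_none hi, h i b hb]

/-- An increasing sequence of words converges to an infinite sequence. -/
lemma exists_forall_isInitial (u : ℕ → List Bool) (hu : ∀ k, u k <+: u (k + 1))
    (hlen : ∀ k, (u k).length < (u (k + 1)).length) : ∃ x, ∀ k, IsInitial (u k) x := by
  have hmono : ∀ j k, j ≤ k → u j <+: u k := fun j k h =>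
    Nat.le_induction (List.prefix_refl _) (fun n _ ih => ih.trans (hu n)) k h
  have hlen' : ∀ k, k ≤ (u k).length := (strictMono_nat_of_lt_succ hlen).id_le
  refine ⟨fun i => (u (i + 1))[i]?.getD false, fun k i b hb => ?_⟩
  rcases le_total k (i + 1) with h | h
  · obtain ⟨t, ht⟩ := hmono _ _ h
    simp only [← ht]
    rw [List.getElem?_append_left (List.getElem?_eq_some_iff.1 hb).1, hb, Option.getD_some]
  · obtain ⟨t, ht⟩ := hmono _ _ h
    rw [← ht, List.getElem?_append_left (hlen' (i + 1))] at hb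
    simp [hb]

/-- The boards `h`, indexed by finite words, are compatible with the common word `u`: the word
played on the board `s` is either empty or an initial segment of `u` patched by `s`. -/
def Compatible (σ : List Word → List Bool) (p : List Bool × (List Bool → List Word)) : Prop :=
  ∀ s, p.2 s = [] ∨
    s.length ≤ p.1.length ∧ answeredWord σ (p.2 s) <+: s ++ p.1.drop s.length

lemma Compatible.exists_extension {σ : List Word → List Bool}
    {p : List Bool × (List Bool → List Word)} (hp : Compatible σ p) (s : List Bool) :
    ∃ q, Compatible σ q ∧ p.1 <+: q.1 ∧ p.1.length < q.1.length ∧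
      ∃ w, q.2 = Function.update p.2 s (w :: p.2 s) := by
  obtain ⟨u, h⟩ := p
  set v := u ++ List.replicate (s.length + 1) false with hv
  have hsv : s.length ≤ v.length := by simp [hv]; omega
  have key : ∃ w : Word, answeredWord σ (h s) ++ w.1 = s ++ v.drop s.length := by
    have hlt : (answeredWord σ (h s)).length < v.length ∧
        answeredWord σ (h s) <+: s ++ v.drop s.length := by
      rcases hp s with h0 | ⟨hle, hpre⟩
      · simp only at h0
        simp [h0, answeredWord, hv]
      · simp only at hle hpre
        refine ⟨?_, hpre.trans ?_⟩
        · have := hpre.length_le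
          simp only [List.length_append, List.length_drop] at this
          simp [hv]; omega
        · rw [hv, List.drop_append_of_le_length hle, ← List.append_assoc]
          exact List.prefix_append _ _
    obtain ⟨hlt, t, ht⟩ := hlt
    refine ⟨⟨t, ?_⟩, ht⟩
    rintro rfl
    have := congrArg List.length ht
    simp only [List.length_append, List.length_drop, List.length_nil] at this
    omega
  obtain ⟨w, hw⟩ := key
  refine ⟨(v ++ σ (w :: h s), Function.update h s (w :: h s)), ?_, ?_, ?_, w, rfl⟩
  · intro r
    by_cases hr : r = s
    · subst hr
      right
      refine ⟨by simp only [List.length_append]; omega, ?_⟩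
      simp only [Function.update_self, answeredWord]
      rw [hw, List.drop_append_of_le_length hsv, List.append_assoc]
    · simp only [Function.update_of_ne hr]
      refine (hp r).imp id fun ⟨hle, hpre⟩ => ?_
      simp only at hle hpre
      refine ⟨by simp [hv]; omega, hpre.trans ?_⟩
      rw [hv, List.append_assoc, List.drop_append_of_le_length hle, ← List.append_assoc]
      exact List.prefix_append _ _
  · exact ⟨_, (List.append_assoc _ _ _).symm⟩
  · simp [hv]

/-- If every position in `P` can be prolonged within `P`, then `P` contains an infinite branch. -/
lemma exists_forall_revHistory {P : List Word → Prop} (h0 : P [])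
    (hstep : ∀ l, P l → ∃ w, P (w :: l)) : ∃ m : ℕ → Word, ∀ n, P (revHistory m n) := by
  choose f hf using fun l : {l // P l} => hstep l.1 l.2
  let r : ℕ → {l // P l} := fun n => Nat.rec ⟨[], h0⟩ (fun _ l => ⟨f l :: l.1, hf l⟩) n
  have hr : ∀ n, revHistory (fun k => f (r k)) n = (r n).1 := by
    intro n
    induction n with
    | zero => rfl
    | succ n ih => rw [revHistory_succ, ih]
  exact ⟨fun k => f (r k), fun n => hr n ▸ (r n).2⟩

/-- Against any answering rule there is a sequence `x` such that all finite modifications of `x`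
can be produced: the plays on countably many boards are simulated simultaneously. -/
theorem exists_forall_patch (σ : List Word → List Bool) :
    ∃ x : Cantor, ∀ s, ∃ m : ℕ → Word, ∀ n,
      IsInitial (answeredWord σ (revHistory m n)) (patch s x) := by
  let v : ℕ → List Bool := fun k => (Encodable.decode k.unpair.1).getD []
  have hv : ∀ s n, ∃ k, n ≤ k ∧ v k = s := fun s n =>
    ⟨Nat.pair (Encodable.encode s) n, Nat.right_le_pair _ _, by simp [v]⟩
  choose f hf hpre hlen hupd using
    fun (p : {p // Compatible σ p}) (k : ℕ) => p.2.exists_extension (v k)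
  let S : ℕ → {p // Compatible σ p} := fun n =>
    Nat.rec ⟨([], fun _ => []), fun _ => Or.inl rfl⟩ (fun k p => ⟨f p k, hf p k⟩) n
  obtain ⟨x, hx⟩ := exists_forall_isInitial (fun k => (S k).1.1)
    (fun k => hpre (S k) k) (fun k => hlen (S k) k)
  have hS : ∀ k, ∃ w, (S (k + 1)).1.2 = Function.update (S k).1.2 (v k) (w :: (S k).1.2 (v k)) :=
    fun k => hupd (S k) k
  refine ⟨x, fun s => ?_⟩
  obtain ⟨m, hm⟩ := exists_forall_revHistory (P := fun l => ∃ k, (S k).1.2 s = l) ⟨0, rfl⟩ (by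
    rintro _ ⟨k, rfl⟩
    obtain ⟨j, hkj, hj⟩ := hv s k
    by_contra! hcon
    have hconst : ∀ i, k ≤ i → (S i).1.2 s = (S k).1.2 s := by
      intro i hi
      induction i, hi using Nat.le_induction with
      | base => rfl
      | succ i _ ih =>
        obtain ⟨w, hw⟩ := hS i
        by_cases hs : s = v i
        · subst hs
          exact absurd (by rw [hw, Function.update_self, ih]) (hcon w (i + 1))
        · rw [hw, Function.update_of_ne hs, ih]
    obtain ⟨w, hw⟩ := hS j
    refine hcon w (j + 1) ?_
    rw [hw, hj, Function.update_self, hconst j hkj])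
  refine ⟨m, fun n => ?_⟩
  obtain ⟨k, hk⟩ := hm n
  rcases (S k).2 s with h | ⟨-, h⟩
  · rw [← hk, h]
    simp [answeredWord, IsInitial]
  · rw [← hk]
    exact ((hx k).patch s).of_prefix h

/-- The concatenation of the first `n` moves of the play. -/
def playWord (e : EgoStrategy) (a : AlterStrategy) (n : ℕ) : List Bool :=
  ((List.range n).map fun i => (moveSeq e a i).1).flatten

lemma playWord_succ (e : EgoStrategy) (a : AlterStrategy) (n : ℕ) :
    playWord e a (n + 1) = playWord e a n ++ (moveSeq e a n).1 := by
  simp [playWord, List.range_succ]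

lemma play_eq_of_isInitial {e : EgoStrategy} {a : AlterStrategy} {x : Cantor}
    (h : ∀ n, ∃ N, n ≤ N ∧ IsInitial (playWord e a N) x) : Play e a = x := by
  have hmono : ∀ j k, j ≤ k → playWord e a j <+: playWord e a k := fun j k h =>
    Nat.le_induction (List.prefix_refl _)
      (fun n _ ih => ih.trans ⟨_, (playWord_succ e a n).symm⟩) k h
  have hlen : ∀ k, k ≤ (playWord e a k).length := by
    intro k
    induction k with
    | zero => simp
    | succ k ih =>
      have := List.length_pos_of_ne_nil (moveSeq e a k).2
      rw [playWord_succ, List.length_append]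
      omega
  funext i
  obtain ⟨N, hN, hx⟩ := h (i + 1)
  have hi : i < (playWord e a (i + 1)).length := hlen (i + 1)
  have hplay : Play e a i = (playWord e a (i + 1))[i] := by
    have : playWord e a (i + 1) =
        (List.ofFn (fun j : Fin (i + 1) => (moveSeq e a j).1)).flatten := by
      rw [playWord, List.ofFn_eq_map, ← List.map_coe_finRange_eq_range, List.map_map]
      rfl
    simp only [Play, ← this, List.getD_eq_getElem _ _ hi]
  rw [hplay]
  exact ((hx.of_prefix (hmono _ _ hN)) i _ (List.getElem?_eq_getElem hi)).symm

lemma moveSeq_even (e : EgoStrategy) (a : AlterStrategy) (n : ℕ) :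
    moveSeq e a (2 * n) = e (hist e a n).1.2 := by
  have h : 2 * n / 2 = n := by omega
  rw [moveSeq, if_pos (by omega), h]
  cases n <;> simp [hist]

lemma moveSeq_odd (e : EgoStrategy) (a : AlterStrategy) (n : ℕ) :
    moveSeq e a (2 * n + 1) = a ⟨(hist e a n).1.1, (hist e a n).2⟩ := by
  have h : (2 * n + 1 + 1) / 2 = n + 1 := by omega
  rw [moveSeq, if_neg (by omega), h]
  simp [hist]

/-- The Ego strategy that plays the words of `m` regardless of the opponent. -/
def egoOfSeq (m : ℕ → Word) : EgoStrategy := fun l => m l.length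

/-- The Alter strategy that plays the words of `m` regardless of the opponent. -/
def alterOfSeq (m : ℕ → Word) : AlterStrategy := fun l => m (l.1.length - 1)

lemma hist_egoOfSeq (m : ℕ → Word) (a : AlterStrategy) (n : ℕ) :
    (hist (egoOfSeq m) a n).1.1 = (List.range (n + 1)).map m ∧
      (hist (egoOfSeq m) a n).1.2.length = n := by
  induction n with
  | zero => simp [hist, egoOfSeq]
  | succ n ih => simp [hist, egoOfSeq, ih.1, ih.2, List.range_succ (n := n + 1)]

lemma hist_alterOfSeq (e : EgoStrategy) (m : ℕ → Word) (n : ℕ) :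
    (hist e (alterOfSeq m) n).1.1.length = n + 1 ∧
      (hist e (alterOfSeq m) n).1.2 = (List.range n).map m := by
  induction n with
  | zero => simp [hist]
  | succ n ih => simp [hist, alterOfSeq, ih.1, ih.2, List.range_succ]

open Classical in
/-- The answering rule on reversed histories given by an Alter strategy. -/
noncomputable def alterAnswer (a : AlterStrategy) (l : List Word) : List Bool :=
  if h : l.reverse ≠ [] then (a ⟨l.reverse, h⟩).1 else []

/-- The answering rule on reversed histories given by an Ego strategy. -/
def egoAnswer (e : EgoStrategy) (l : List Word) : List Bool := (e l.reverse).1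

lemma playWord_egoOfSeq (m : ℕ → Word) (a : AlterStrategy) (n : ℕ) :
    playWord (egoOfSeq m) a (2 * n) = answeredWord (alterAnswer a) (revHistory m n) := by
  induction n with
  | zero => rfl
  | succ n ih =>
    obtain ⟨h1, h2⟩ := hist_egoOfSeq m a n
    have h3 : (revHistory m (n + 1)).reverse = (hist (egoOfSeq m) a n).1.1 := by
      rw [h1, revHistory, List.reverse_reverse]
    have h4 : alterAnswer a (revHistory m (n + 1)) =
        (a ⟨(hist (egoOfSeq m) a n).1.1, (hist (egoOfSeq m) a n).2⟩).1 := by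
      have hne := (hist (egoOfSeq m) a n).2
      rw [← h3] at hne
      rw [alterAnswer, dif_pos hne]
      congr 3
    rw [show 2 * (n + 1) = 2 * n + 1 + 1 by ring, playWord_succ, playWord_succ, ih,
      moveSeq_even, moveSeq_odd, ← h4, revHistory_succ, answeredWord, egoOfSeq, h2]

lemma playWord_alterOfSeq (e : EgoStrategy) (m : ℕ → Word) (n : ℕ) :
    playWord e (alterOfSeq m) (2 * n + 1) =
      (e []).1 ++ answeredWord (egoAnswer e) (revHistory m n) := by
  induction n with
  | zero =>
    rw [playWord_succ, moveSeq_even]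
    simp [playWord, hist, revHistory, answeredWord]
  | succ n ih =>
    have h2 := (hist_alterOfSeq e m (n + 1)).2
    have h3 : egoAnswer e (revHistory m (n + 1)) = (e (hist e (alterOfSeq m) (n + 1)).1.2).1 := by
      rw [egoAnswer, h2, revHistory, List.reverse_reverse]
    rw [playWord_succ, moveSeq_even, ← h3, show 2 * (n + 1) = 2 * n + 1 + 1 by ring,
      playWord_succ, ih, moveSeq_odd, revHistory_succ, answeredWord]
    simp [alterOfSeq, (hist_alterOfSeq e m n).1]

lemma play_egoOfSeq {m : ℕ → Word} {a : AlterStrategy} {x : Cantor}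
    (h : ∀ n, IsInitial (answeredWord (alterAnswer a) (revHistory m n)) x) :
    Play (egoOfSeq m) a = x :=
  play_eq_of_isInitial fun n => ⟨2 * n, by omega, by rw [playWord_egoOfSeq]; exact h n⟩

lemma play_alterOfSeq {e : EgoStrategy} {m : ℕ → Word} {x : Cantor}
    (h : ∀ n, IsInitial (answeredWord (egoAnswer e) (revHistory m n)) x) :
    Play e (alterOfSeq m) = patch (e []).1 fun i => x (i - (e []).1.length) := by
  refine play_eq_of_isInitial fun n => ⟨2 * n + 1, by omega, ?_⟩
  rw [playWord_alterOfSeq]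
  intro i b hb
  rcases lt_or_ge i (e []).1.length with hi | hi
  · rw [List.getElem?_append_left hi] at hb
    simp [patch, hb]
  · rw [List.getElem?_append_right hi] at hb
    simp [patch, List.getElem?_eq_none hi, h n _ b hb]

lemma exists_patch_eq_of_simRel {x t : Cantor} (h : simRel x t) : ∃ s, patch s x = t := by
  obtain ⟨N, hN⟩ := (Set.encard_lt_top_iff.1 h).bddAbove
  refine ⟨(List.range (N + 1)).map t, funext fun i => ?_⟩
  rcases lt_or_ge i (N + 1) with hi | hi
  · simp [patch, hi]
  · have : x i = t i := by
      by_contra hne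
      have := hN hne
      omega
    simp [patch, this, List.getElem?_eq_none, hi]

/-- If `T` is thin and meets every `∼`-class, then the Banach–Mazur game `G(T)`
is undetermined. -/
theorem game_undetermined_of_thin_meets_every_class (T : Set Cantor) (hthin : IsThin T)
    (hmeet : ∀ z : Cantor, (T ∩ simClass z).Nonempty) :
    (¬ ∃ e : EgoStrategy, ∀ a : AlterStrategy, Play e a ∈ T) ∧
    (¬ ∃ a : AlterStrategy, ∀ e : EgoStrategy, Play e a ∉ T) := by
  constructor
  · rintro ⟨e, he⟩
    obtain ⟨x, hx⟩ := exists_forall_patch (egoAnswer e)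
    obtain ⟨m₀, h₀⟩ := hx [false]
    obtain ⟨m₁, h₁⟩ := hx [true]
    have p₀ := play_alterOfSeq h₀
    have p₁ := play_alterOfSeq h₁
    have hne : Play e (alterOfSeq m₀) ≠ Play e (alterOfSeq m₁) := by
      intro h
      have := congrFun (p₀.symm.trans (h.trans p₁)) (e []).1.length
      simp [patch] at this
    have hle : hd (Play e (alterOfSeq m₀)) (Play e (alterOfSeq m₁)) ≤ 1 := by
      rw [← Set.encard_singleton (e []).1.length]
      refine Set.encard_le_encard fun i hi => ?_
      by_contra hne
      refine hi ?_
      rw [p₀, p₁]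
      rcases lt_or_ge i (e []).1.length with hlt | hge
      · simp [patch, hlt]
      · have hpos : 1 ≤ i - (e []).1.length := by
          have : i ≠ (e []).1.length := hne
          omega
        simp [patch, List.getElem?_eq_none, hpos]
    exact absurd ((hthin _ (he _) _ (he _) hne).trans hle) (by norm_num)
  · rintro ⟨a, ha⟩
    obtain ⟨x, hx⟩ := exists_forall_patch (alterAnswer a)
    obtain ⟨t, htT, ht⟩ := hmeet x
    obtain ⟨s, rfl⟩ := exists_patch_eq_of_simRel ht
    obtain ⟨m, hm⟩ := hx s
    exact ha (egoOfSeq m) (play_egoOfSeq hm ▸ htT)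
end

section
/- Every maximal thin set T ⊆ ℤ₂^ω is neither a Borel subset nor a meager subset of the Cantor cube. -/
open MeasureTheory

/-- The sequence `x` with its `n`-th coordinate negated. -/
def flipAt (n : ℕ) (x : Cantor) : Cantor := Function.update x n (!x n)

theorem flipAt_involutive (n : ℕ) : Function.Involutive (flipAt n) := by
  intro x
  simp [flipAt]

theorem continuous_flipAt (n : ℕ) : Continuous (flipAt n) :=
  continuous_id.update n ((continuous_of_discreteTopology (f := not)).comp (continuous_apply n))

/-- Negating the `n`-th coordinate, as a self-homeomorphism of the Cantor cube. -/
def flipHomeomorph (n : ℕ) : Cantor ≃ₜ Cantor where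
  toEquiv := (flipAt_involutive n).toPerm
  continuous_toFun := continuous_flipAt n
  continuous_invFun := continuous_flipAt n

theorem isOpenMap_flipAt (n : ℕ) : IsOpenMap (flipAt n) :=
  (flipHomeomorph n).isOpenMap

theorem setOf_ne_flipAt (n : ℕ) (x : Cantor) : {k | x k ≠ flipAt n x k} = {n} := by
  ext k
  by_cases h : k = n
  · subst h
    simp [flipAt]
  · simp [flipAt, h]

theorem hd_flipAt (n : ℕ) (x : Cantor) : hd x (flipAt n x) = 1 := by
  rw [hd, setOf_ne_flipAt, Set.encard_singleton]

theorem hd_comm (x y : Cantor) : hd x y = hd y x := by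
  simp only [hd, ne_comm]

/-- Distinct points at Hamming distance less than two differ in exactly one coordinate. -/
theorem exists_eq_flipAt_of_hd_lt_two {x y : Cantor} (hne : x ≠ y) (h : hd x y < 2) :
    ∃ n, y = flipAt n x := by
  have hle : hd x y ≤ 1 := by
    rw [← one_add_one_eq_two] at h
    exact Order.le_of_lt_add_one h
  obtain ⟨m, hm⟩ := Function.ne_iff.mp hne
  have huniq := Set.encard_le_one_iff.mp hle
  refine ⟨m, funext fun k => ?_⟩
  by_cases hk : k = m
  · subst hk
    simpa [flipAt] using (Bool.eq_not_of_ne (Ne.symm hm))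
  · by_contra hxy
    refine hk (huniq k m (fun hxk => hxy ?_) hm)
    simp [flipAt, hk, hxk]

theorem tendsto_flipAt_atTop (x : Cantor) :
    Filter.Tendsto (fun n => flipAt n x) Filter.atTop (nhds x) := by
  refine tendsto_pi_nhds.mpr fun k => tendsto_const_nhds.congr' ?_
  filter_upwards [Filter.eventually_gt_atTop k] with n hn
  simp [flipAt, hn.ne]

theorem IsThin.flipAt_notMem {T : Set Cantor} (hT : IsThin T) {x : Cantor} (hx : x ∈ T) (n : ℕ) :
    flipAt n x ∉ T := by
  intro hy
  have hne : x ≠ flipAt n x := fun h => by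
    simpa [flipAt] using congrFun h n
  have := hT x hx _ hy hne
  rw [hd_flipAt] at this
  exact absurd this (by decide)

/-- A point outside a maximal thin set is a single flip away from it. -/
theorem exists_flipAt_mem_of_maximal {T : Set Cantor} (hthin : IsThin T)
    (hmax : ∀ S : Set Cantor, IsThin S → T ⊆ S → S = T) {x : Cantor} (hx : x ∉ T) :
    ∃ n, flipAt n x ∈ T := by
  by_contra! hflip
  have hfar : ∀ y ∈ T, x ≠ y → 2 ≤ hd x y := by
    intro y hy hne
    by_contra! hlt
    obtain ⟨n, rfl⟩ := exists_eq_flipAt_of_hd_lt_two hne hlt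
    exact hflip n hy
  have hins : IsThin (insert x T) := by
    rintro y (rfl | hy) z (rfl | hz) hne
    · exact absurd rfl hne
    · exact hfar z hz hne
    · exact hd_comm z y ▸ hfar y hy hne.symm
    · exact hthin y hy z hz hne
  exact hx (hmax _ hins (Set.subset_insert x T) ▸ Set.mem_insert x T)

theorem not_isMeagre_of_maximal {T : Set Cantor} (hthin : IsThin T)
    (hmax : ∀ S : Set Cantor, IsThin S → T ⊆ S → S = T) : ¬ IsMeagre T := by
  intro hT
  have hU : IsMeagre (T ∪ ⋃ n, flipAt n ⁻¹' T) :=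
    hT.union (isMeagre_iUnion fun n =>
      hT.preimage_of_isOpenMap (continuous_flipAt n) (isOpenMap_flipAt n))
  have huniv : T ∪ ⋃ n, flipAt n ⁻¹' T = Set.univ := by
    refine Set.eq_univ_of_forall fun x => ?_
    by_cases hx : x ∈ T
    · exact Or.inl hx
    · exact Or.inr (Set.mem_iUnion.mpr (exists_flipAt_mem_of_maximal hthin hmax hx))
  rw [huniv, IsMeagre, Set.compl_univ] at hU
  obtain ⟨x, hx⟩ := (dense_of_mem_residual hU).nonempty
  exact hx

/-- A thin set with the Baire property is meager. -/
theorem IsThin.isMeagre_of_baireMeasurableSet {T : Set Cantor} (hthin : IsThin T)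
    (hT : BaireMeasurableSet T) : IsMeagre T := by
  obtain ⟨u, hu, hTu⟩ := hT.residualEq_isOpen
  rcases u.eq_empty_or_nonempty with rfl | ⟨x, hx⟩
  · filter_upwards [Filter.eventuallyEq_set.mp hTu] with y hy using fun h => hy.mp h
  · obtain ⟨n, hn⟩ := ((tendsto_flipAt_atTop x).eventually (hu.mem_nhds hx)).exists
    have hflip := (tendsto_residual_of_isOpenMap (continuous_flipAt n)
      (isOpenMap_flipAt n)).eventually (Filter.eventuallyEq_set.mp hTu)
    have hdense := dense_of_mem_residual ((Filter.eventuallyEq_set.mp hTu).and hflip)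
    obtain ⟨y, ⟨hy, hny⟩, hyT, hnyT⟩ := hdense.inter_open_nonempty _
      (hu.inter (hu.preimage (continuous_flipAt n))) ⟨x, hx, hn⟩
    exact absurd (hnyT.mpr hny) (hthin.flipAt_notMem (hyT.mpr hy) n)

/-- Corollary: maximal thin sets are neither Borel nor meager. -/
theorem maximal_thin_not_borel_not_meager (T : Set Cantor) (hthin : IsThin T)
    (hmax : ∀ S : Set Cantor, IsThin S → T ⊆ S → S = T) :
    ¬ MeasurableSet[borel Cantor] T ∧ ¬ IsMeagre T := by
  have hmeagre := not_isMeagre_of_maximal hthin hmax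
  refine ⟨fun hT => hmeagre (hthin.isMeagre_of_baireMeasurableSet ?_), hmeagre⟩
  rw [← BorelSpace.measurable_eq (α := Cantor)] at hT
  exact hT.baireMeasurableSet
end
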